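/- arXiv:gr-qc/9902044 — 2 statements merged into one kernel-verified Lean document; each statement's English description precedes it below -/
import Mathlib

section
/- Ostrogradsky theorem for constrained systems: a sufficiently differentiable curve x : ℝ → ℝ^K satisfies the Euler–Lagrange equations E_k = 0 of the (possibly singular) higher-order Lagrangian L if and only if the phase-space curve defined by q_{k,γ}(t) := x_k^{(γ)}(t) together with the Ostrogradsky momenta p_{k,γ}(t) satisfies, for all k and 0 ≤ γ ≤ α_k−1, the Hamilton–Dirac equations dq_{k,γ}/dt = ∂H_c/∂p_{k,γ} + Σ_i ω^i(t) ∂φ_i/∂p_{k,γ} and dp_{k,γ}/dt = −∂H_c/∂q_{k,γ} − Σ_i ω^i(t) ∂φ_i/∂q_{k,γ}, where all partial derivatives are evaluated at (q(t), p(t)), ω^i(t) := ω^i(q(t), (x_k^{(α_k)}(t))_k), and H_c(q,p) := H_r(q, (p_{l,α_l−1})_l) + Σ_k Σ_{β=1}^{α_k−1} q_{k,β} p_{k,β−1}. -/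
noncomputable section

/-- The partial derivative `∂L/∂x_k^{(σ)}` of the higher-order Lagrangian `L`
at the jet point `a`, i.e. the directional derivative of `L` in the direction of
the jet coordinate `x_k^{(σ)}`. -/
def jetPD {K : ℕ} {α : Fin K → ℕ}
    (L : (∀ k : Fin K, Fin (α k + 1) → ℝ) → ℝ)
    (a : ∀ k : Fin K, Fin (α k + 1) → ℝ) (k : Fin K) (σ : Fin (α k + 1)) : ℝ :=
  fderiv ℝ L a (Pi.single k (Pi.single σ 1))

/-- The jet `J(t) = (x_k^{(γ)}(t))_{k, 0 ≤ γ ≤ α_k}` of a curve `x`. -/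
def jetOf {K : ℕ} (α : Fin K → ℕ) (x : ℝ → Fin K → ℝ) (t : ℝ) :
    ∀ k : Fin K, Fin (α k + 1) → ℝ :=
  fun k γ => iteratedDeriv (γ : ℕ) (fun s => x s k) t

/-- The truncated jet `(x_k^{(γ)}(t))_{k, 0 ≤ γ ≤ α_k − 1}` of a curve `x`. -/
def tjetOf {K : ℕ} (α : Fin K → ℕ) (x : ℝ → Fin K → ℝ) (t : ℝ) :
    ∀ k : Fin K, Fin (α k) → ℝ :=
  fun k γ => iteratedDeriv (γ : ℕ) (fun s => x s k) t

/-- The `k`-th Euler–Lagrange expression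
`E_k(t) = Σ_{σ=0}^{α_k} (−1)^σ (d/dt)^σ [(∂L/∂x_k^{(σ)}) ∘ J](t)` along the curve `x`. -/
def eulerLagrange {K : ℕ} {α : Fin K → ℕ}
    (L : (∀ k : Fin K, Fin (α k + 1) → ℝ) → ℝ)
    (x : ℝ → Fin K → ℝ) (k : Fin K) (t : ℝ) : ℝ :=
  ∑ σ : Fin (α k + 1),
    (-1 : ℝ) ^ (σ : ℕ) * iteratedDeriv (σ : ℕ) (fun s => jetPD L (jetOf α x s) k σ) t

/-- Packing a configuration point `q = (q_{k,γ})_{0 ≤ γ ≤ α_k − 1}` and top velocities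
`v = (v_k)` into a jet point. -/
def packQV {K : ℕ} (α : Fin K → ℕ) (q : ∀ k : Fin K, Fin (α k) → ℝ)
    (v : Fin K → ℝ) : ∀ k : Fin K, Fin (α k + 1) → ℝ :=
  fun k γ => if h : (γ : ℕ) < α k then q k ⟨γ, h⟩ else v k

/-- The momentum map of `L` regarded as a function of the configuration variables
`q = (q_{k,γ})` and the top velocities `v = (v_k)`:  `p̂(q,v)_k := ∂(L∘pack)/∂v_k`. -/
def phatQ {K : ℕ} (α : Fin K → ℕ)
    (L : (∀ k : Fin K, Fin (α k + 1) → ℝ) → ℝ)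
    (q : ∀ k : Fin K, Fin (α k) → ℝ) (v : Fin K → ℝ) (k : Fin K) : ℝ :=
  fderiv ℝ (fun w : (∀ k : Fin K, Fin (α k) → ℝ) × (Fin K → ℝ) => L (packQV α w.1 w.2))
    (q, v) (0, Pi.single k 1)

/-- The canonical Hamiltonian
`H_c(q,p) := H_r(q, (p_{l,α_l−1})_l) + Σ_k Σ_{β=1}^{α_k−1} q_{k,β} p_{k,β−1}`. -/
def canonHC {K : ℕ} (α : Fin K → ℕ) (hα : ∀ k, 1 ≤ α k)
    (Hr : (∀ k : Fin K, Fin (α k) → ℝ) × (Fin K → ℝ) → ℝ)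
    (qp : (∀ k : Fin K, Fin (α k) → ℝ) × (∀ k : Fin K, Fin (α k) → ℝ)) : ℝ :=
  Hr (qp.1, fun k => qp.2 k ⟨α k - 1, Nat.sub_lt (hα k) Nat.one_pos⟩)
    + ∑ k : Fin K, ∑ β : Fin (α k),
        if 1 ≤ (β : ℕ) then
          qp.1 k β * qp.2 k ⟨(β : ℕ) - 1, lt_of_le_of_lt (Nat.sub_le _ _) β.isLt⟩
        else 0

/-- A constraint function `φ(q, π)` of the configuration and the top momenta, lifted to a
function on the full phase space `(q, p)`. -/
def liftConstraint {K : ℕ} (α : Fin K → ℕ) (hα : ∀ k, 1 ≤ α k)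
    (φ : (∀ k : Fin K, Fin (α k) → ℝ) × (Fin K → ℝ) → ℝ)
    (qp : (∀ k : Fin K, Fin (α k) → ℝ) × (∀ k : Fin K, Fin (α k) → ℝ)) : ℝ :=
  φ (qp.1, fun k => qp.2 k ⟨α k - 1, Nat.sub_lt (hα k) Nat.one_pos⟩)

/-- The coordinate functional `p ↦ p_{k,γ}`. -/
def coordCLM {K : ℕ} (α : Fin K → ℕ) (k : Fin K) (γ : Fin (α k)) :
    (∀ k : Fin K, Fin (α k) → ℝ) →L[ℝ] ℝ :=
  (ContinuousLinearMap.proj (R := ℝ) (φ := fun _ : Fin (α k) => ℝ) γ).comp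
    (ContinuousLinearMap.proj (R := ℝ) (φ := fun k : Fin K => Fin (α k) → ℝ) k)

/-- The linear map sending the momenta `(p_{k,γ})` to the top momenta `(p_{k,α_k−1})`. -/
def topMomenta {K : ℕ} (α : Fin K → ℕ) (hα : ∀ k, 1 ≤ α k) :
    (∀ k : Fin K, Fin (α k) → ℝ) →L[ℝ] (Fin K → ℝ) :=
  ContinuousLinearMap.pi fun k => coordCLM α k ⟨α k - 1, Nat.sub_lt (hα k) Nat.one_pos⟩

lemma topMomenta_apply {K : ℕ} (α : Fin K → ℕ) (hα : ∀ k, 1 ≤ α k)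
    (p : ∀ k : Fin K, Fin (α k) → ℝ) (k : Fin K) :
    topMomenta α hα p k = p k ⟨α k - 1, Nat.sub_lt (hα k) Nat.one_pos⟩ := rfl

lemma topMomenta_single {K : ℕ} (α : Fin K → ℕ) (hα : ∀ k, 1 ≤ α k)
    (k : Fin K) (γ : Fin (α k)) :
    topMomenta α hα (Pi.single k (Pi.single γ 1)) =
      if (γ : ℕ) + 1 = α k then Pi.single k 1 else 0 := by
  have hk := hα k
  ext l
  rw [topMomenta_apply]
  rcases eq_or_ne l k with rfl | hl
  · rw [Pi.single_eq_same]
    split_ifs with h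
    · rw [Pi.single_eq_same, show γ = ⟨α l - 1, Nat.sub_lt (hα l) Nat.one_pos⟩ from
        Fin.ext (show (γ : ℕ) = α l - 1 by omega), Pi.single_eq_same]
    · rw [Pi.single_eq_of_ne, Pi.zero_apply]
      intro h'
      have : α l - 1 = (γ : ℕ) := congrArg Fin.val h'
      omega
  · rw [Pi.single_eq_of_ne hl]
    split_ifs <;> simp [hl]

lemma hasFDerivAt_liftConstraint {K : ℕ} (α : Fin K → ℕ) (hα : ∀ k, 1 ≤ α k)
    (φ : (∀ k : Fin K, Fin (α k) → ℝ) × (Fin K → ℝ) → ℝ) (hφ : Differentiable ℝ φ)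
    (q p : ∀ k : Fin K, Fin (α k) → ℝ) :
    HasFDerivAt (liftConstraint α hα φ)
      ((fderiv ℝ φ (q, topMomenta α hα p)).comp
        ((ContinuousLinearMap.id ℝ _).prodMap (topMomenta α hα))) (q, p) :=
  HasFDerivAt.comp (g := φ) (f := Prod.map id (topMomenta α hα))
    (q, p) (hφ (q, topMomenta α hα p)).hasFDerivAt
    ((hasFDerivAt_id q).prodMap (q, p) (topMomenta α hα).hasFDerivAt)

lemma fderiv_liftConstraint {K : ℕ} (α : Fin K → ℕ) (hα : ∀ k, 1 ≤ α k)
    (φ : (∀ k : Fin K, Fin (α k) → ℝ) × (Fin K → ℝ) → ℝ) (hφ : Differentiable ℝ φ)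
    (q p e f : ∀ k : Fin K, Fin (α k) → ℝ) :
    fderiv ℝ (liftConstraint α hα φ) (q, p) (e, f) =
      fderiv ℝ φ (q, topMomenta α hα p) (e, topMomenta α hα f) := by
  rw [(hasFDerivAt_liftConstraint α hα φ hφ q p).fderiv]
  rfl

lemma fderiv_canonHC {K : ℕ} (α : Fin K → ℕ) (hα : ∀ k, 1 ≤ α k)
    (Hr : (∀ k : Fin K, Fin (α k) → ℝ) × (Fin K → ℝ) → ℝ) (hHr : Differentiable ℝ Hr)
    (q p e f : ∀ k : Fin K, Fin (α k) → ℝ) :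
    fderiv ℝ (canonHC α hα Hr) (q, p) (e, f) =
      fderiv ℝ Hr (q, topMomenta α hα p) (e, topMomenta α hα f) +
        ∑ k : Fin K, ∑ β : Fin (α k),
          if 1 ≤ (β : ℕ) then
            q k β * f k ⟨(β : ℕ) - 1, lt_of_le_of_lt (Nat.sub_le _ _) β.isLt⟩ +
              p k ⟨(β : ℕ) - 1, lt_of_le_of_lt (Nat.sub_le _ _) β.isLt⟩ * e k β
          else 0 := by
  have hsum := HasFDerivAt.fun_sum (u := Finset.univ) fun (k : Fin K) _ =>
    HasFDerivAt.fun_sum (u := Finset.univ) fun (β : Fin (α k)) _ =>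
      show HasFDerivAt
        (fun qp : (∀ k : Fin K, Fin (α k) → ℝ) × (∀ k : Fin K, Fin (α k) → ℝ) =>
          if 1 ≤ (β : ℕ) then
            qp.1 k β * qp.2 k ⟨(β : ℕ) - 1, lt_of_le_of_lt (Nat.sub_le _ _) β.isLt⟩
          else 0)
        (if 1 ≤ (β : ℕ) then
          q k β • (coordCLM α k ⟨(β : ℕ) - 1, lt_of_le_of_lt (Nat.sub_le _ _) β.isLt⟩).comp
              (ContinuousLinearMap.snd ℝ _ _) +
            p k ⟨(β : ℕ) - 1, lt_of_le_of_lt (Nat.sub_le _ _) β.isLt⟩ •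
              (coordCLM α k β).comp (ContinuousLinearMap.fst ℝ _ _)
        else 0) (q, p) by
      split_ifs with h
      · exact ((coordCLM α k β).hasFDerivAt.comp (q, p) hasFDerivAt_fst).mul
          ((coordCLM α k ⟨(β : ℕ) - 1, lt_of_le_of_lt (Nat.sub_le _ _) β.isLt⟩).hasFDerivAt.comp
            (q, p) hasFDerivAt_snd)
      · exact hasFDerivAt_const _ _
  have hadd : HasFDerivAt (canonHC α hα Hr) _ (q, p) :=
    (hasFDerivAt_liftConstraint α hα Hr hHr q p).fun_add hsum
  rw [hadd.fderiv]
  simp only [_root_.add_apply, _root_.sum_apply]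
  congr 1
  refine Finset.sum_congr rfl fun k _ => Finset.sum_congr rfl fun β _ => ?_
  split_ifs <;> rfl

lemma fderiv_canonHC_momentum {K : ℕ} (α : Fin K → ℕ) (hα : ∀ k, 1 ≤ α k)
    (Hr : (∀ k : Fin K, Fin (α k) → ℝ) × (Fin K → ℝ) → ℝ) (hHr : Differentiable ℝ Hr)
    (q p : ∀ k : Fin K, Fin (α k) → ℝ) (k : Fin K) (γ : Fin (α k)) :
    fderiv ℝ (canonHC α hα Hr) (q, p) (0, Pi.single k (Pi.single γ 1)) =
      fderiv ℝ Hr (q, topMomenta α hα p)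
        (0, topMomenta α hα (Pi.single k (Pi.single γ 1))) +
        if h : (γ : ℕ) + 1 < α k then q k ⟨γ + 1, h⟩ else 0 := by
  rw [fderiv_canonHC α hα Hr hHr, Finset.sum_eq_single k]
  · congr 1
    simp only [Pi.zero_apply, mul_zero, add_zero, Pi.single_eq_same, Pi.single_apply,
      Fin.ext_iff]
    split_ifs with h
    · rw [Finset.sum_eq_single ⟨γ + 1, h⟩]
      · simp
      · intro β _ hβ
        rw [Ne, Fin.ext_iff] at hβ
        simp only at hβ ⊢
        split_ifs <;> first | omega | simp
      · simp
    · refine Finset.sum_eq_zero fun β _ => ?_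
      split_ifs <;> first | omega | simp
  · intro l _ hl
    refine Finset.sum_eq_zero fun β _ => ?_
    simp [hl]
  · simp

lemma fderiv_canonHC_configuration {K : ℕ} (α : Fin K → ℕ) (hα : ∀ k, 1 ≤ α k)
    (Hr : (∀ k : Fin K, Fin (α k) → ℝ) × (Fin K → ℝ) → ℝ) (hHr : Differentiable ℝ Hr)
    (q p : ∀ k : Fin K, Fin (α k) → ℝ) (k : Fin K) (γ : Fin (α k)) :
    fderiv ℝ (canonHC α hα Hr) (q, p) (Pi.single k (Pi.single γ 1), 0) =
      fderiv ℝ Hr (q, topMomenta α hα p) (Pi.single k (Pi.single γ 1), 0) +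
        if 1 ≤ (γ : ℕ) then
          p k ⟨(γ : ℕ) - 1, lt_of_le_of_lt (Nat.sub_le _ _) γ.isLt⟩ else 0 := by
  rw [fderiv_canonHC α hα Hr hHr, Finset.sum_eq_single k, Finset.sum_eq_single γ]
  · simp
  · intro β _ hβ
    simp [hβ]
  · simp
  · intro l _ hl
    refine Finset.sum_eq_zero fun β _ => ?_
    simp [hl]
  · simp

/-- `packQV` as a continuous linear map. -/
def packCLM {K : ℕ} (α : Fin K → ℕ) :
    (∀ k : Fin K, Fin (α k) → ℝ) × (Fin K → ℝ) →L[ℝ] (∀ k : Fin K, Fin (α k + 1) → ℝ) :=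
  LinearMap.toContinuousLinearMap
    { toFun := fun w => packQV α w.1 w.2
      map_add' := fun w w' => by
        ext k γ
        simp only [packQV, Prod.fst_add, Prod.snd_add, Pi.add_apply]
        split_ifs <;> rfl
      map_smul' := fun c w => by
        ext k γ
        simp only [packQV, Prod.smul_fst, Prod.smul_snd, Pi.smul_apply, RingHom.id_apply]
        split_ifs <;> rfl }

lemma packCLM_apply {K : ℕ} (α : Fin K → ℕ)
    (w : (∀ k : Fin K, Fin (α k) → ℝ) × (Fin K → ℝ)) :
    packCLM α w = packQV α w.1 w.2 := rfl

lemma packQV_zero_single {K : ℕ} (α : Fin K → ℕ) (k : Fin K) :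
    packQV α 0 (Pi.single k 1) = Pi.single k (Pi.single (Fin.last (α k)) 1) := by
  ext l γ
  rcases eq_or_ne l k with rfl | hl
  · have := γ.isLt
    simp only [packQV, Pi.zero_apply, Pi.single_eq_same, Pi.single_apply, Fin.ext_iff,
      Fin.val_last]
    split_ifs <;> first | omega | rfl
  · simp [packQV, hl]

lemma packQV_single_zero {K : ℕ} (α : Fin K → ℕ) (k : Fin K) (γ : Fin (α k)) :
    packQV α (Pi.single k (Pi.single γ 1)) 0 = Pi.single k (Pi.single γ.castSucc 1) := by
  ext l δ
  rcases eq_or_ne l k with rfl | hl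
  · have := γ.isLt
    simp only [packQV, Pi.zero_apply, Pi.single_eq_same, Pi.single_apply, Fin.ext_iff,
      Fin.val_castSucc]
    split_ifs <;> first | omega | rfl
  · simp [packQV, hl]

lemma phatQ_eq_fderiv {K : ℕ} (α : Fin K → ℕ)
    (L : (∀ k : Fin K, Fin (α k + 1) → ℝ) → ℝ) (hL : Differentiable ℝ L)
    (q : ∀ k : Fin K, Fin (α k) → ℝ) (v : Fin K → ℝ) (k : Fin K) :
    phatQ α L q v k = jetPD L (packQV α q v) k (Fin.last (α k)) := by
  have h : HasFDerivAt
      (fun w : (∀ k : Fin K, Fin (α k) → ℝ) × (Fin K → ℝ) => L (packQV α w.1 w.2))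
      ((fderiv ℝ L (packQV α q v)).comp (packCLM α)) (q, v) :=
    HasFDerivAt.comp (g := L) (q, v) (hL (packCLM α (q, v))).hasFDerivAt
      (packCLM α).hasFDerivAt
  rw [phatQ, h.fderiv, ContinuousLinearMap.comp_apply, packCLM_apply, packQV_zero_single,
    jetPD]

lemma contDiff_jetPD {K : ℕ} {α : Fin K → ℕ}
    {L : (∀ k : Fin K, Fin (α k + 1) → ℝ) → ℝ} (hL : ContDiff ℝ (⊤ : ℕ∞) L)
    (k : Fin K) (σ : Fin (α k + 1)) :
    ContDiff ℝ (⊤ : ℕ∞) (fun a => jetPD L a k σ) :=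
  (hL.fderiv_right (m := (⊤ : ℕ∞)) (by simp)).clm_apply contDiff_const

/-- The derivative of the restricted Hamiltonian plus multiplied constraints in the
configuration directions is minus the corresponding derivative of the Lagrangian. -/
lemma fderiv_restricted_add_constraints {K R : ℕ} (α : Fin K → ℕ)
    (L : (∀ k : Fin K, Fin (α k + 1) → ℝ) → ℝ) (hL : ContDiff ℝ (⊤ : ℕ∞) L)
    (Hr : (∀ k : Fin K, Fin (α k) → ℝ) × (Fin K → ℝ) → ℝ) (hHr : Differentiable ℝ Hr)
    (φ : Fin R → (∀ k : Fin K, Fin (α k) → ℝ) × (Fin K → ℝ) → ℝ)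
    (hφ : ∀ i, Differentiable ℝ (φ i))
    (q : ∀ k : Fin K, Fin (α k) → ℝ) (v : Fin K → ℝ) (c : Fin R → ℝ)
    (hHrL : ∀ q v,
      Hr (q, phatQ α L q v) = (∑ k : Fin K, phatQ α L q v k * v k) - L (packQV α q v))
    (hconstr : ∀ (i : Fin R) q v, φ i (q, phatQ α L q v) = 0)
    (hmult : ∀ k : Fin K,
      v k = fderiv ℝ Hr (q, phatQ α L q v) (0, Pi.single k 1)
        + ∑ i : Fin R, c i * fderiv ℝ (φ i) (q, phatQ α L q v) (0, Pi.single k 1))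
    (e : ∀ k : Fin K, Fin (α k) → ℝ) :
    fderiv ℝ Hr (q, phatQ α L q v) (e, 0)
        + ∑ i : Fin R, c i * fderiv ℝ (φ i) (q, phatQ α L q v) (e, 0)
      = - fderiv ℝ L (packQV α q v) (packQV α e 0) := by
  have hLd : Differentiable ℝ L := hL.differentiable (by simp)
  let ι : (∀ k : Fin K, Fin (α k) → ℝ) →L[ℝ] (∀ k : Fin K, Fin (α k) → ℝ) × (Fin K → ℝ) :=
    ContinuousLinearMap.inl ℝ _ _
  have hpack : HasFDerivAt (fun q' => packQV α q' v) ((packCLM α).comp ι) q :=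
    HasFDerivAt.comp (g := packCLM α) (f := fun q' => (q', v)) q (packCLM α).hasFDerivAt
      (hasFDerivAt_prodMk_left q v)
  have hphat : DifferentiableAt ℝ (fun q' => phatQ α L q' v) q := by
    rw [differentiableAt_pi]
    intro k
    simp only [phatQ_eq_fderiv α L hLd]
    exact (((contDiff_jetPD hL k _).differentiable (by simp)) _).comp q hpack.differentiableAt
  have hP := hphat.hasFDerivAt
  set P := fderiv ℝ (fun q' => phatQ α L q' v) q
  have hpair : HasFDerivAt (fun q' => (q', phatQ α L q' v))
      ((ContinuousLinearMap.id ℝ _).prod P) q := (hasFDerivAt_id q).prodMk hP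
  have split_apply (ψ : (∀ k : Fin K, Fin (α k) → ℝ) × (Fin K → ℝ) →L[ℝ] ℝ) :
      ψ (e, P e) = ψ (e, 0) + ∑ k, P e k * ψ (0, Pi.single k 1) := by
    have h0 : (e, P e) = (e, (0 : Fin K → ℝ)) +
        ∑ k, P e k • ((0 : ∀ k : Fin K, Fin (α k) → ℝ), (Pi.single k 1 : Fin K → ℝ)) := by
      ext l
      · simp [Prod.fst_sum]
      · simp [Prod.snd_sum, Finset.sum_apply, Pi.single_apply]
    rw [h0, map_add, map_sum]
    simp only [map_smul, smul_eq_mul]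
  have hH : fderiv ℝ Hr (q, phatQ α L q v) (e, P e) =
      (∑ k, P e k * v k) - fderiv ℝ L (packQV α q v) (packQV α e 0) := by
    have h1 : HasFDerivAt (fun q' => Hr (q', phatQ α L q' v)) _ q :=
      HasFDerivAt.comp (g := Hr) q (hHr _).hasFDerivAt hpair
    have h2 : HasFDerivAt (fun q' => L (packQV α q' v)) _ q :=
      HasFDerivAt.comp (g := L) q (hLd _).hasFDerivAt hpack
    have h3 := HasFDerivAt.fun_sum (u := Finset.univ) fun (k : Fin K) _ =>
      ((hasFDerivAt_pi'.1 hP) k).mul_const (v k)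
    have h4 := h3.fun_sub h2
    simp only [hHrL] at h1
    have := congrArg (fun T => T e) (h1.unique h4)
    simpa [ι, packCLM_apply, mul_comm] using this
  have hC (i : Fin R) : fderiv ℝ (φ i) (q, phatQ α L q v) (e, P e) = 0 := by
    have h1 : HasFDerivAt (fun q' => φ i (q', phatQ α L q' v)) _ q :=
      HasFDerivAt.comp (g := φ i) q (hφ i _).hasFDerivAt hpair
    simp only [hconstr] at h1
    simpa using congrArg (fun T => T e) (h1.unique (hasFDerivAt_const 0 q))
  rw [split_apply] at hH
  simp only [split_apply] at hC
  have hv : ∑ k, P e k * v k = ∑ k, P e k * fderiv ℝ Hr (q, phatQ α L q v) (0, Pi.single k 1)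
      + ∑ i, c i * ∑ k, P e k * fderiv ℝ (φ i) (q, phatQ α L q v) (0, Pi.single k 1) := by
    simp only [Finset.mul_sum]
    rw [Finset.sum_comm, ← Finset.sum_add_distrib]
    refine Finset.sum_congr rfl fun k _ => ?_
    conv_lhs => rw [hmult k]
    rw [mul_add, Finset.mul_sum]
    congr 1
    exact Finset.sum_congr rfl fun i _ => by ring
  have hcs : ∑ i, c i * fderiv ℝ (φ i) (q, phatQ α L q v) (e, 0) =
      - ∑ i, c i * ∑ k, P e k * fderiv ℝ (φ i) (q, phatQ α L q v) (0, Pi.single k 1) := by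
    rw [← Finset.sum_neg_distrib]
    exact Finset.sum_congr rfl fun i _ => by linear_combination c i * hC i
  linarith

/-- Solving the backward recursion for the momenta yields the alternating sum of iterated
derivatives that appears in the Euler–Lagrange expression. -/
lemma sub_deriv_eq_alternating_sum (n : ℕ) : ∀ (f p : ℕ → ℝ → ℝ),
    (∀ σ, ContDiff ℝ (⊤ : ℕ∞) (f σ)) → p n = f (n + 1) →
    (∀ β < n, p β = fun t => f (β + 1) t - deriv (p (β + 1)) t) → ∀ t,
    f 0 t - deriv (p 0) t =
      ∑ σ ∈ Finset.range (n + 2), (-1 : ℝ) ^ σ * iteratedDeriv σ (f σ) t := by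
  induction n with
  | zero =>
    intro f p _ htop _ t
    simp [Finset.sum_range_succ, htop, sub_eq_add_neg]
  | succ n ih =>
    intro f p hf htop hrec t
    have h := ih (fun σ => f (σ + 1)) (fun β => p (β + 1)) (fun σ => hf _) htop
      (fun β hβ => hrec (β + 1) (by omega))
    have hp : p 0 = fun s => ∑ σ ∈ Finset.range (n + 2),
        (-1 : ℝ) ^ σ * iteratedDeriv σ (f (σ + 1)) s := by
      rw [hrec 0 (by omega)]
      exact funext h
    rw [Finset.sum_range_succ', hp, deriv_fun_sum]
    · simp only [deriv_const_mul_field, ← iteratedDeriv_succ, pow_zero, iteratedDeriv_zero,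
        one_mul, pow_succ, mul_neg, mul_one, neg_mul, Finset.sum_neg_distrib]
      ring
    · intro σ _
      exact (((hf (σ + 1)).differentiable_iteratedDeriv σ
        (by exact_mod_cast ENat.natCast_lt_top σ)) t).const_mul _

lemma contDiff_jetOf {K : ℕ} (α : Fin K → ℕ) (x : ℝ → Fin K → ℝ)
    (hx : ∀ k, ContDiff ℝ (⊤ : ℕ∞) (fun t => x t k)) :
    ContDiff ℝ (⊤ : ℕ∞) (jetOf α x) := by
  refine contDiff_pi.2 fun k => contDiff_pi.2 fun γ => ?_
  simp only [jetOf, iteratedDeriv_eq_iterate]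
  exact (hx k).iterate_deriv _

lemma packQV_tjetOf {K : ℕ} (α : Fin K → ℕ) (x : ℝ → Fin K → ℝ) (t : ℝ) :
    packQV α (tjetOf α x t) (fun l => iteratedDeriv (α l) (fun s => x s l) t) =
      jetOf α x t := by
  ext k γ
  simp only [packQV, tjetOf, jetOf]
  split_ifs with h
  · rfl
  · exact congrArg (fun n => iteratedDeriv n (fun s => x s k) t)
      (show α k = (γ : ℕ) by have := γ.isLt; omega)

/-- The Euler–Lagrange expression in terms of the lowest Ostrogradsky momentum. -/
lemma eulerLagrange_eq_sub_deriv {K : ℕ} {α : Fin K → ℕ}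
    (L : (∀ k : Fin K, Fin (α k + 1) → ℝ) → ℝ) (hL : ContDiff ℝ (⊤ : ℕ∞) L)
    (x : ℝ → Fin K → ℝ) (hx : ∀ k, ContDiff ℝ (⊤ : ℕ∞) (fun t => x t k))
    (k : Fin K) (hk : 1 ≤ α k) (p : ℕ → ℝ → ℝ)
    (hptop : ∀ t, p (α k - 1) t = jetPD L (jetOf α x t) k ⟨α k, Nat.lt_succ_self _⟩)
    (hprec : ∀ (β : ℕ) (_h1 : 1 ≤ β) (_h2 : β ≤ α k - 1) (t : ℝ),
      p (β - 1) t = jetPD L (jetOf α x t) k ⟨β, by omega⟩ - deriv (p β) t) (t : ℝ) :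
    eulerLagrange L x k t = jetPD L (jetOf α x t) k 0 - deriv (p 0) t := by
  let f : ℕ → ℝ → ℝ := fun σ s =>
    if h : σ < α k + 1 then jetPD L (jetOf α x s) k ⟨σ, h⟩ else 0
  have hf (σ : ℕ) (h : σ < α k + 1) : f σ = fun s => jetPD L (jetOf α x s) k ⟨σ, h⟩ :=
    funext fun s => dif_pos h
  have hfs (σ : ℕ) : ContDiff ℝ (⊤ : ℕ∞) (f σ) := by
    by_cases h : σ < α k + 1
    · rw [hf σ h]
      exact (contDiff_jetPD hL k _).comp (contDiff_jetOf α x hx)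
    · rw [show f σ = fun _ => 0 from funext fun s => dif_neg h]
      exact contDiff_const
  have key := sub_deriv_eq_alternating_sum (α k - 1) f p hfs
    (by rw [hf _ (by omega)]
        funext s
        rw [hptop]
        congr 2
        omega)
    (fun β hβ => by
        rw [hf _ (by omega)]
        funext s
        exact hprec (β + 1) (by omega) (by omega) s) t
  rw [show α k - 1 + 2 = α k + 1 by omega, hf 0 (by omega)] at key
  rw [show jetPD L (jetOf α x t) k 0 = jetPD L (jetOf α x t) k ⟨0, by omega⟩ from rfl, key,
    eulerLagrange, ← Fin.sum_univ_eq_sum_range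
      (fun σ => (-1 : ℝ) ^ σ * iteratedDeriv σ (f σ) t)]
  refine Finset.sum_congr rfl fun σ _ => ?_
  rw [hf σ σ.isLt]

/-- **Ostrogradsky's theorem for constrained (possibly singular) higher-order systems:**
the Euler–Lagrange equations hold iff the jet/Ostrogradsky-momenta phase-space curve
satisfies the Hamilton–Dirac equations. -/
theorem ostrogradsky_theorem_constrained
    (K R : ℕ) (hK : 1 ≤ K) (α : Fin K → ℕ) (hα : ∀ k, 1 ≤ α k)
    (L : (∀ k : Fin K, Fin (α k + 1) → ℝ) → ℝ) (hL : ContDiff ℝ (⊤ : ℕ∞) L)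
    (x : ℝ → Fin K → ℝ) (hx : ∀ k, ContDiff ℝ (⊤ : ℕ∞) (fun t => x t k))
    (p : Fin K → ℕ → ℝ → ℝ)
    (hptop : ∀ k t, p k (α k - 1) t = jetPD L (jetOf α x t) k ⟨α k, Nat.lt_succ_self _⟩)
    (hprec : ∀ (k : Fin K) (β : ℕ) (_h1 : 1 ≤ β) (_h2 : β ≤ α k - 1) (t : ℝ),
      p k (β - 1) t = jetPD L (jetOf α x t) k ⟨β, by omega⟩ - deriv (p k β) t)
    (Hr : (∀ k : Fin K, Fin (α k) → ℝ) × (Fin K → ℝ) → ℝ)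
    (hHr : ContDiff ℝ (⊤ : ℕ∞) Hr)
    (φ : Fin R → (∀ k : Fin K, Fin (α k) → ℝ) × (Fin K → ℝ) → ℝ)
    (hφ : ∀ i, ContDiff ℝ (⊤ : ℕ∞) (φ i))
    (ω : Fin R → (∀ k : Fin K, Fin (α k) → ℝ) × (Fin K → ℝ) → ℝ)
    (hω : ∀ i, ContDiff ℝ (⊤ : ℕ∞) (ω i))
    (hHrL : ∀ q v,
      Hr (q, phatQ α L q v) = (∑ k : Fin K, phatQ α L q v k * v k) - L (packQV α q v))
    (hconstr : ∀ (i : Fin R) q v, φ i (q, phatQ α L q v) = 0)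
    (hmult : ∀ q v (k : Fin K),
      v k = fderiv ℝ Hr (q, phatQ α L q v) (0, Pi.single k 1)
        + ∑ i : Fin R, ω i (q, v) * fderiv ℝ (φ i) (q, phatQ α L q v) (0, Pi.single k 1)) :
    (∀ k t, eulerLagrange L x k t = 0) ↔
      (∀ (k : Fin K) (γ : Fin (α k)) (t : ℝ),
        (deriv (fun s => tjetOf α x s k γ) t =
          fderiv ℝ (canonHC α hα Hr) (tjetOf α x t, fun l δ => p l (δ : ℕ) t)
              (0, Pi.single k (Pi.single γ 1))
            + ∑ i : Fin R,
                ω i (tjetOf α x t, fun l => iteratedDeriv (α l) (fun s => x s l) t) *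
                  fderiv ℝ (liftConstraint α hα (φ i))
                    (tjetOf α x t, fun l δ => p l (δ : ℕ) t)
                    (0, Pi.single k (Pi.single γ 1))) ∧
        (deriv (fun s => p k (γ : ℕ) s) t =
          - fderiv ℝ (canonHC α hα Hr) (tjetOf α x t, fun l δ => p l (δ : ℕ) t)
              (Pi.single k (Pi.single γ 1), 0)
            - ∑ i : Fin R,
                ω i (tjetOf α x t, fun l => iteratedDeriv (α l) (fun s => x s l) t) *
                  fderiv ℝ (liftConstraint α hα (φ i))
                    (tjetOf α x t, fun l δ => p l (δ : ℕ) t)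
                    (Pi.single k (Pi.single γ 1), 0))) := by
  have hHrd : Differentiable ℝ Hr := hHr.differentiable (by simp)
  have hφd (i : Fin R) : Differentiable ℝ (φ i) := (hφ i).differentiable (by simp)
  have hLd : Differentiable ℝ L := hL.differentiable (by simp)
  have htop (t : ℝ) : topMomenta α hα (fun l δ => p l (δ : ℕ) t) =
      phatQ α L (tjetOf α x t) (fun l => iteratedDeriv (α l) (fun s => x s l) t) := by
    ext k
    rw [topMomenta_apply, phatQ_eq_fderiv α L hLd, packQV_tjetOf]
    exact hptop k t
  have hvel (k : Fin K) (γ : Fin (α k)) (t : ℝ) :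
      deriv (fun s => tjetOf α x s k γ) t =
        fderiv ℝ (canonHC α hα Hr) (tjetOf α x t, fun l δ => p l (δ : ℕ) t)
            (0, Pi.single k (Pi.single γ 1))
          + ∑ i : Fin R,
              ω i (tjetOf α x t, fun l => iteratedDeriv (α l) (fun s => x s l) t) *
                fderiv ℝ (liftConstraint α hα (φ i))
                  (tjetOf α x t, fun l δ => p l (δ : ℕ) t)
                  (0, Pi.single k (Pi.single γ 1)) := by
    have hd : deriv (fun s => tjetOf α x s k γ) t =
        iteratedDeriv ((γ : ℕ) + 1) (fun s => x s k) t := by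
      rw [iteratedDeriv_succ]
      rfl
    simp only [fderiv_canonHC_momentum α hα Hr hHrd,
      fderiv_liftConstraint α hα _ (hφd _), topMomenta_single, htop, hd]
    by_cases h : (γ : ℕ) + 1 = α k
    · have hm := hmult (tjetOf α x t) (fun l => iteratedDeriv (α l) (fun s => x s l) t) k
      simp only [h, if_true, lt_irrefl, dif_neg, not_false_eq_true, add_zero]
      exact hm
    · have h' : (γ : ℕ) + 1 < α k := by omega
      have hz : ((0 : ∀ k : Fin K, Fin (α k) → ℝ), (0 : Fin K → ℝ)) = 0 := rfl
      simp only [h, if_false, h', dif_pos, hz, map_zero, mul_zero, Finset.sum_const_zero,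
        add_zero, zero_add]
      rfl
  have hforce (k : Fin K) (γ : Fin (α k)) (t : ℝ) :
      - fderiv ℝ (canonHC α hα Hr) (tjetOf α x t, fun l δ => p l (δ : ℕ) t)
            (Pi.single k (Pi.single γ 1), 0)
          - ∑ i : Fin R,
              ω i (tjetOf α x t, fun l => iteratedDeriv (α l) (fun s => x s l) t) *
                fderiv ℝ (liftConstraint α hα (φ i))
                  (tjetOf α x t, fun l δ => p l (δ : ℕ) t)
                  (Pi.single k (Pi.single γ 1), 0) =
        jetPD L (jetOf α x t) k γ.castSucc - if 1 ≤ (γ : ℕ) then p k ((γ : ℕ) - 1) t else 0 := by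
    have h := fderiv_restricted_add_constraints α L hL Hr hHrd φ hφd (tjetOf α x t)
      (fun l => iteratedDeriv (α l) (fun s => x s l) t) _ hHrL hconstr (hmult _ _)
      (Pi.single k (Pi.single γ 1))
    rw [packQV_tjetOf, packQV_single_zero] at h
    simp only [fderiv_canonHC_configuration α hα Hr hHrd,
      fderiv_liftConstraint α hα _ (hφd _), map_zero, htop, jetPD]
    linarith
  have hEL (k : Fin K) := eulerLagrange_eq_sub_deriv L hL x hx k (hα k) (p k) (hptop k) (hprec k)
  constructor
  · intro hE k γ t
    refine ⟨hvel k γ t, ?_⟩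
    rw [hforce]
    split_ifs with h
    · have := hprec k γ h (by omega) t
      rw [this]
      exact (sub_sub_cancel _ _).symm
    · have h0 := hE k t
      rw [hEL, sub_eq_zero] at h0
      obtain ⟨γ, hγ⟩ := γ
      obtain rfl : γ = 0 := by simpa using h
      rw [sub_zero]
      exact h0.symm
  · intro hH k t
    have h := (hH k ⟨0, hα k⟩ t).2
    rw [hforce] at h
    rw [hEL, sub_eq_zero]
    simpa using h.symm
end
end

section
/- With the stated definitions one has the identities B₁₁ + B₂₂ = (√3/3) Π̇₋ and B₁₁ − B₂₂ = (1/3) Π̇₊ − 2 B₀₀. Consequently, combined with the identity H = 3B₀₀, the Bach equations B₀₀ = B₁₁ = B₂₂ = 0 hold if and only if H = 0, Π̇₊ = 0 and Π̇₋ = 0; i.e. the Bianchi-type I canonical equations of conformal gravity together with the super-Hamiltonian constraint are equivalent to the corresponding Bach field equations. -/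
noncomputable section

/-- `K₊ := -√6 β̇₊`. -/
def mKp (βp : ℝ → ℝ) : ℝ → ℝ := fun t => -Real.sqrt 6 * deriv βp t

/-- `K₋ := -√6 β̇₋`. -/
def mKm (βm : ℝ → ℝ) : ℝ → ℝ := fun t => -Real.sqrt 6 * deriv βm t

/-- `𝔭₊ := (√6/3)(K₋² − K₊²) − K̇₊`. -/
def mPp (βp βm : ℝ → ℝ) : ℝ → ℝ := fun t =>
  Real.sqrt 6 / 3 * ((mKm βm t) ^ 2 - (mKp βp t) ^ 2) - deriv (mKp βp) t

/-- `𝔭₋ := (2√6/3)K₊K₋ − K̇₋`. -/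
def mPm (βp βm : ℝ → ℝ) : ℝ → ℝ := fun t =>
  2 * Real.sqrt 6 / 3 * (mKp βp t * mKm βm t) - deriv (mKm βm) t

/-- `Π₊ := √6 𝔭̇₊ + 4K₋𝔭₋ − 4K₊𝔭₊`. -/
def mPip (βp βm : ℝ → ℝ) : ℝ → ℝ := fun t =>
  Real.sqrt 6 * deriv (mPp βp βm) t + 4 * mKm βm t * mPm βp βm t
    - 4 * mKp βp t * mPp βp βm t

/-- `Π₋ := √6 𝔭̇₋ + 4K₋𝔭₊ + 4K₊𝔭₋`. -/
def mPim (βp βm : ℝ → ℝ) : ℝ → ℝ := fun t =>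
  Real.sqrt 6 * deriv (mPm βp βm) t + 4 * mKm βm t * mPp βp βm t
    + 4 * mKp βp t * mPm βp βm t

/-- The super-Hamiltonian of conformal gravity for Bianchi type I. -/
def mH (βp βm : ℝ → ℝ) : ℝ → ℝ := fun t =>
  Real.sqrt 6 / 6 *
      (4 * mPm βp βm t * mKp βp t * mKm βm t
        - 2 * mPp βp βm t * ((mKp βp t) ^ 2 - (mKm βm t) ^ 2)
        - mKp βp t * mPip βp βm t - mKm βm t * mPim βp βm t)
    - 1 / 2 * ((mPp βp βm t) ^ 2 + (mPm βp βm t) ^ 2)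

/-- Time–time component of the Bach tensor of the Bianchi-type I metric. -/
def mB00 (βp βm : ℝ → ℝ) : ℝ → ℝ := fun t =>
  2 * deriv (deriv (deriv βm)) t * deriv βm t - (deriv (deriv βm) t) ^ 2
    - 12 * (deriv βm t) ^ 4 - 24 * (deriv βm t) ^ 2 * (deriv βp t) ^ 2
    + 2 * deriv (deriv (deriv βp)) t * deriv βp t - (deriv (deriv βp) t) ^ 2
    - 12 * (deriv βp t) ^ 4

/-- `B₁₁` component of the Bach tensor of the Bianchi-type I metric. -/
def mB11 (βp βm : ℝ → ℝ) : ℝ → ℝ := fun t =>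
  Real.sqrt 3 *
      (deriv (deriv (deriv (deriv βm))) t
        - 24 * deriv (deriv βm) t * (deriv βm t) ^ 2
        - 8 * deriv (deriv βm) t * (deriv βp t) ^ 2
        - 16 * deriv βm t * deriv (deriv βp) t * deriv βp t)
    - 2 * deriv (deriv (deriv βm)) t * deriv βm t + (deriv (deriv βm) t) ^ 2
    - 16 * deriv (deriv βm) t * deriv βm t * deriv βp t + 12 * (deriv βm t) ^ 4
    - 8 * (deriv βm t) ^ 2 * deriv (deriv βp) t
    + 24 * (deriv βm t) ^ 2 * (deriv βp t) ^ 2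
    + deriv (deriv (deriv (deriv βp))) t
    - 2 * deriv (deriv (deriv βp)) t * deriv βp t + (deriv (deriv βp) t) ^ 2
    - 24 * deriv (deriv βp) t * (deriv βp t) ^ 2 + 12 * (deriv βp t) ^ 4

/-- `B₂₂` component of the Bach tensor of the Bianchi-type I metric. -/
def mB22 (βp βm : ℝ → ℝ) : ℝ → ℝ := fun t =>
  Real.sqrt 3 *
      (deriv (deriv (deriv (deriv βm))) t
        - 24 * deriv (deriv βm) t * (deriv βm t) ^ 2
        - 8 * deriv (deriv βm) t * (deriv βp t) ^ 2
        - 16 * deriv βm t * deriv (deriv βp) t * deriv βp t)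
    + 2 * deriv (deriv (deriv βm)) t * deriv βm t - (deriv (deriv βm) t) ^ 2
    + 16 * deriv (deriv βm) t * deriv βm t * deriv βp t - 12 * (deriv βm t) ^ 4
    + 8 * (deriv βm t) ^ 2 * deriv (deriv βp) t
    - 24 * (deriv βm t) ^ 2 * (deriv βp t) ^ 2
    - deriv (deriv (deriv (deriv βp))) t
    + 2 * deriv (deriv (deriv βp)) t * deriv βp t - (deriv (deriv βp) t) ^ 2
    + 24 * deriv (deriv βp) t * (deriv βp t) ^ 2 - 12 * (deriv βp t) ^ 4

section MisnerVariables

variable {βp βm : ℝ → ℝ}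

lemma deriv_mKp (βp : ℝ → ℝ) :
    deriv (mKp βp) = fun t => -Real.sqrt 6 * deriv (deriv βp) t := by
  funext t
  exact deriv_const_mul_field _

lemma deriv_mKm (βm : ℝ → ℝ) :
    deriv (mKm βm) = fun t => -Real.sqrt 6 * deriv (deriv βm) t := by
  funext t
  exact deriv_const_mul_field _

lemma mPp_eq (βp βm : ℝ → ℝ) :
    mPp βp βm = fun t =>
      Real.sqrt 6 * (deriv (deriv βp) t + 2 * ((deriv βm t) ^ 2 - (deriv βp t) ^ 2)) := by
  have h6 : Real.sqrt 6 ^ 2 = 6 := Real.sq_sqrt (by norm_num)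
  funext t
  simp only [mPp, deriv_mKp, mKp, mKm]
  linear_combination Real.sqrt 6 / 3 * ((deriv βm t) ^ 2 - (deriv βp t) ^ 2) * h6

lemma mPm_eq (βp βm : ℝ → ℝ) :
    mPm βp βm = fun t =>
      Real.sqrt 6 * (deriv (deriv βm) t + 4 * (deriv βp t * deriv βm t)) := by
  have h6 : Real.sqrt 6 ^ 2 = 6 := Real.sq_sqrt (by norm_num)
  funext t
  simp only [mPm, deriv_mKm, mKp, mKm]
  linear_combination 2 * Real.sqrt 6 / 3 * (deriv βp t * deriv βm t) * h6

lemma mPip_eq (hβp2 : Differentiable ℝ (deriv βp)) (hβp3 : Differentiable ℝ (deriv (deriv βp)))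
    (hβm2 : Differentiable ℝ (deriv βm)) :
    mPip βp βm = fun t =>
      6 * deriv (deriv (deriv βp)) t - 48 * (deriv βp t * (deriv βm t) ^ 2)
        - 48 * (deriv βp t) ^ 3 := by
  have h6 : Real.sqrt 6 ^ 2 = 6 := Real.sq_sqrt (by norm_num)
  funext t
  have hd := ((hβp3 t).hasDerivAt.add ((((hβm2 t).hasDerivAt.pow 2).sub
    ((hβp2 t).hasDerivAt.pow 2)).const_mul 2)).const_mul (Real.sqrt 6)
  have hP : deriv (mPp βp βm) t = Real.sqrt 6 * (deriv (deriv (deriv βp)) t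
      + 2 * (2 * deriv βm t * deriv (deriv βm) t - 2 * deriv βp t * deriv (deriv βp) t)) := by
    rw [mPp_eq]
    exact hd.deriv.trans (by norm_num)
  rw [mPip, hP]
  simp only [mPp_eq, mPm_eq, mKp, mKm]
  linear_combination (deriv (deriv (deriv βp)) t - 8 * (deriv βp t * (deriv βm t) ^ 2)
    - 8 * (deriv βp t) ^ 3) * h6

lemma mPim_eq (hβp2 : Differentiable ℝ (deriv βp)) (hβm2 : Differentiable ℝ (deriv βm))
    (hβm3 : Differentiable ℝ (deriv (deriv βm))) :
    mPim βp βm = fun t =>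
      6 * deriv (deriv (deriv βm)) t - 48 * ((deriv βp t) ^ 2 * deriv βm t)
        - 48 * (deriv βm t) ^ 3 := by
  have h6 : Real.sqrt 6 ^ 2 = 6 := Real.sq_sqrt (by norm_num)
  funext t
  have hd := ((hβm3 t).hasDerivAt.add (((hβp2 t).hasDerivAt.mul
    (hβm2 t).hasDerivAt).const_mul 4)).const_mul (Real.sqrt 6)
  have hP : deriv (mPm βp βm) t = Real.sqrt 6 * (deriv (deriv (deriv βm)) t
      + 4 * (deriv (deriv βp) t * deriv βm t + deriv βp t * deriv (deriv βm) t)) := by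
    rw [mPm_eq]
    exact hd.deriv
  rw [mPim, hP]
  simp only [mPp_eq, mPm_eq, mKp, mKm]
  linear_combination (deriv (deriv (deriv βm)) t - 8 * ((deriv βp t) ^ 2 * deriv βm t)
    - 8 * (deriv βm t) ^ 3) * h6

lemma deriv_mPip (hβp2 : Differentiable ℝ (deriv βp))
    (hβp3 : Differentiable ℝ (deriv (deriv βp)))
    (hβp4 : Differentiable ℝ (deriv (deriv (deriv βp))))
    (hβm2 : Differentiable ℝ (deriv βm)) (t : ℝ) :
    deriv (mPip βp βm) t =
      6 * deriv (deriv (deriv (deriv βp))) t - 48 * (deriv (deriv βp) t * (deriv βm t) ^ 2)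
        - 96 * (deriv βp t * deriv βm t * deriv (deriv βm) t)
        - 144 * ((deriv βp t) ^ 2 * deriv (deriv βp) t) := by
  have hd := (((hβp4 t).hasDerivAt.const_mul 6).sub (((hβp2 t).hasDerivAt.mul
    ((hβm2 t).hasDerivAt.pow 2)).const_mul 48)).sub (((hβp2 t).hasDerivAt.pow 3).const_mul 48)
  rw [mPip_eq hβp2 hβp3 hβm2]
  refine hd.deriv.trans ?_
  simp only [Pi.pow_apply]
  push_cast
  ring

lemma deriv_mPim (hβp2 : Differentiable ℝ (deriv βp)) (hβm2 : Differentiable ℝ (deriv βm))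
    (hβm3 : Differentiable ℝ (deriv (deriv βm)))
    (hβm4 : Differentiable ℝ (deriv (deriv (deriv βm)))) (t : ℝ) :
    deriv (mPim βp βm) t =
      6 * deriv (deriv (deriv (deriv βm))) t - 48 * ((deriv βp t) ^ 2 * deriv (deriv βm) t)
        - 96 * (deriv βp t * deriv (deriv βp) t * deriv βm t)
        - 144 * ((deriv βm t) ^ 2 * deriv (deriv βm) t) := by
  have hd := (((hβm4 t).hasDerivAt.const_mul 6).sub ((((hβp2 t).hasDerivAt.pow 2).mul
    (hβm2 t).hasDerivAt).const_mul 48)).sub (((hβm2 t).hasDerivAt.pow 3).const_mul 48)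
  rw [mPim_eq hβp2 hβm2 hβm3]
  refine hd.deriv.trans ?_
  simp only [Pi.pow_apply]
  push_cast
  ring

lemma mH_eq_three_mul_mB00 (hβp2 : Differentiable ℝ (deriv βp))
    (hβp3 : Differentiable ℝ (deriv (deriv βp))) (hβm2 : Differentiable ℝ (deriv βm))
    (hβm3 : Differentiable ℝ (deriv (deriv βm))) (t : ℝ) :
    mH βp βm t = 3 * mB00 βp βm t := by
  have h6 : Real.sqrt 6 ^ 2 = 6 := Real.sq_sqrt (by norm_num)
  have h6' : Real.sqrt 6 ^ 4 = 36 := by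
    rw [show Real.sqrt 6 ^ 4 = (Real.sqrt 6 ^ 2) ^ 2 by ring, h6]; norm_num
  simp only [mH, mB00, mPip_eq hβp2 hβp3 hβm2, mPim_eq hβp2 hβm2 hβm3, mPp_eq, mPm_eq, mKp, mKm]
  ring_nf
  rw [h6, h6']
  ring

end MisnerVariables

/-- **For Bianchi type I the canonical equations of conformal gravity together with the
super-Hamiltonian constraint are equivalent to the Bach field equations:**
`B₁₁ + B₂₂ = (√3/3) Π̇₋`, `B₁₁ − B₂₂ = (1/3) Π̇₊ − 2B₀₀`, and consequently
`B₀₀ = B₁₁ = B₂₂ = 0` iff `H = 0`, `Π̇₊ = 0` and `Π̇₋ = 0`. -/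
theorem bach_equations_iff_canonical
    (βp βm : ℝ → ℝ)
    (hβp1 : Differentiable ℝ βp) (hβp2 : Differentiable ℝ (deriv βp))
    (hβp3 : Differentiable ℝ (deriv (deriv βp)))
    (hβp4 : Differentiable ℝ (deriv (deriv (deriv βp))))
    (hβm1 : Differentiable ℝ βm) (hβm2 : Differentiable ℝ (deriv βm))
    (hβm3 : Differentiable ℝ (deriv (deriv βm)))
    (hβm4 : Differentiable ℝ (deriv (deriv (deriv βm)))) :
    (∀ t, mB11 βp βm t + mB22 βp βm t = Real.sqrt 3 / 3 * deriv (mPim βp βm) t) ∧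
    (∀ t, mB11 βp βm t - mB22 βp βm t
      = 1 / 3 * deriv (mPip βp βm) t - 2 * mB00 βp βm t) ∧
    ((∀ t, mB00 βp βm t = 0 ∧ mB11 βp βm t = 0 ∧ mB22 βp βm t = 0) ↔
      (∀ t, mH βp βm t = 0 ∧ deriv (mPip βp βm) t = 0 ∧ deriv (mPim βp βm) t = 0)) := by
  have hsum : ∀ t, mB11 βp βm t + mB22 βp βm t = Real.sqrt 3 / 3 * deriv (mPim βp βm) t := by
    intro t
    rw [deriv_mPim hβp2 hβm2 hβm3 hβm4, mB11, mB22]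
    ring
  have hdiff : ∀ t, mB11 βp βm t - mB22 βp βm t
      = 1 / 3 * deriv (mPip βp βm) t - 2 * mB00 βp βm t := by
    intro t
    rw [deriv_mPip hβp2 hβp3 hβp4 hβm2, mB11, mB22, mB00]
    ring
  refine ⟨hsum, hdiff, forall_congr' fun t => ?_⟩
  have hH := mH_eq_three_mul_mB00 hβp2 hβp3 hβm2 hβm3 t
  have hs := hsum t
  have hd := hdiff t
  constructor
  · rintro ⟨h0, h1, h2⟩
    rw [h1, h2, add_zero, zero_eq_mul] at hs
    exact ⟨by linarith, by linarith, hs.resolve_left (by positivity)⟩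
  · rintro ⟨h0, h1, h2⟩
    rw [h2, mul_zero] at hs
    exact ⟨by linarith, by linarith, by linarith⟩
end
end
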